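/- There is no tripartite pure state |Ψ⟩_ABC whose reduced states ρ_AC and ρ_BC are both separable while ρ_AB is PPT and entangled. -/

import Mathlib

open Matrix BigOperators
open scoped ComplexOrder

noncomputable section

/-- A density matrix: positive semidefinite with trace one. -/
def IsDensity {α : Type*} [Fintype α] (ρ : Matrix α α ℂ) : Prop :=
  ρ.PosSemidef ∧ ρ.trace = 1

/-- Tensor (Kronecker) product of matrices on a product index type. -/
def tens {α β : Type*} (σ : Matrix α α ℂ) (τ : Matrix β β ℂ) :
    Matrix (α × β) (α × β) ℂ :=
  fun p q => σ p.1 q.1 * τ p.2 q.2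

/-- Separability: a finite convex combination of product density matrices. -/
def SeparableState {α β : Type*} [Fintype α] [Fintype β]
    (ρ : Matrix (α × β) (α × β) ℂ) : Prop :=
  ∃ (k : ℕ) (p : Fin k → ℝ) (σ : Fin k → Matrix α α ℂ) (τ : Fin k → Matrix β β ℂ),
    (∀ i, 0 ≤ p i) ∧ ∑ i, p i = 1 ∧ (∀ i, IsDensity (σ i)) ∧ (∀ i, IsDensity (τ i)) ∧
    ρ = ∑ i, (p i : ℂ) • tens (σ i) (τ i)

/-- Partial transpose with respect to the second system. -/
def ptransB {α β : Type*} (ρ : Matrix (α × β) (α × β) ℂ) :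
    Matrix (α × β) (α × β) ℂ :=
  fun p q => ρ (p.1, q.2) (q.1, p.2)

/-- Partial trace over the second system. -/
def ptrB {α β : Type*} [Fintype β] (ρ : Matrix (α × β) (α × β) ℂ) : Matrix α α ℂ :=
  fun i k => ∑ j, ρ (i, j) (k, j)

/-- Partial trace over the first system. -/
def ptrA {α β : Type*} [Fintype α] (ρ : Matrix (α × β) (α × β) ℂ) : Matrix β β ℂ :=
  fun j l => ∑ i, ρ (i, j) (i, l)

/-- Rank-one projection |ψ⟩⟨ψ| associated with a vector. -/
def projv {α : Type*} (ψ : α → ℂ) : Matrix α α ℂ :=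
  fun x y => ψ x * (starRingEnd ℂ) (ψ y)

/-- Unit vector condition. -/
def UnitVec {α : Type*} [Fintype α] (ψ : α → ℂ) : Prop :=
  ∑ x, Complex.normSq (ψ x) = 1

/-- Two-party reduced state ρ_АБ of a tripartite pure state. -/
def rhoAB {α β γ : Type*} [Fintype γ] (ψ : α × β × γ → ℂ) :
    Matrix (α × β) (α × β) ℂ :=
  fun p q => ∑ c, ψ (p.1, p.2, c) * (starRingEnd ℂ) (ψ (q.1, q.2, c))

def rhoBC {α β γ : Type*} [Fintype α] (ψ : α × β × γ → ℂ) :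
    Matrix (β × γ) (β × γ) ℂ :=
  fun p q => ∑ a, ψ (a, p.1, p.2) * (starRingEnd ℂ) (ψ (a, q.1, q.2))

def rhoAC {α β γ : Type*} [Fintype β] (ψ : α × β × γ → ℂ) :
    Matrix (α × γ) (α × γ) ℂ :=
  fun p q => ∑ b, ψ (p.1, b, p.2) * (starRingEnd ℂ) (ψ (q.1, b, q.2))

def rhoA {α β γ : Type*} [Fintype β] [Fintype γ] (ψ : α × β × γ → ℂ) :
    Matrix α α ℂ :=
  fun x y => ∑ b, ∑ c, ψ (x, b, c) * (starRingEnd ℂ) (ψ (y, b, c))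

def rhoB {α β γ : Type*} [Fintype α] [Fintype γ] (ψ : α × β × γ → ℂ) :
    Matrix β β ℂ :=
  fun x y => ∑ a, ∑ c, ψ (a, x, c) * (starRingEnd ℂ) (ψ (a, y, c))

def rhoC {α β γ : Type*} [Fintype α] [Fintype β] (ψ : α × β × γ → ℂ) :
    Matrix γ γ ℂ :=
  fun x y => ∑ a, ∑ b, ψ (a, b, x) * (starRingEnd ℂ) (ψ (a, b, y))

/-- `x` majorizes `y` (for nonnegative vectors, with implicit zero padding):
the sum of any `|T|` entries of `y` is dominated by some choice of at most
`|T|` entries of `x`, and the total sums agree. -/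
def Majorizes {α β : Type*} [Fintype α] [Fintype β] (x : α → ℝ) (y : β → ℝ) : Prop :=
  (∀ T : Finset β, ∃ S : Finset α, S.card ≤ T.card ∧ ∑ i ∈ T, y i ≤ ∑ i ∈ S, x i) ∧
  ∑ i, x i = ∑ i, y i

/-- Von Neumann entropy of a Hermitian matrix, via its eigenvalues. -/
def vN {α : Type*} [Fintype α] [DecidableEq α] {ρ : Matrix α α ℂ}
    (h : ρ.IsHermitian) : ℝ :=
  -∑ i, h.eigenvalues i * Real.log (h.eigenvalues i)

/-- Tensor rank of a tripartite vector: least number of product vectors summing to it. -/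
def tensorRank {α β γ : Type*} [Fintype α] [Fintype β] [Fintype γ]
    (ψ : α × β × γ → ℂ) : ℕ :=
  sInf {r : ℕ | ∃ (a : Fin r → α → ℂ) (b : Fin r → β → ℂ) (c : Fin r → γ → ℂ),
    ∀ x, ψ x = ∑ i, a i x.1 * b i x.2.1 * c i x.2.2}

/-- Orthonormal family of vectors. -/
def OrthonormalFam {α : Type*} [Fintype α] {k : ℕ} (v : Fin k → α → ℂ) : Prop :=
  ∀ i j, ∑ x, (starRingEnd ℂ) (v i x) * v j x = if i = j then 1 else 0

/-- Maximally correlated state: ρ = Σ_{i,j} c_{ij} |i_B⟩⟨j_B| ⊗ |i_C⟩⟨j_C|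
for some orthonormal families. -/
def IsMaxCorrelated {β γ : Type*} [Fintype β] [Fintype γ]
    (ρ : Matrix (β × γ) (β × γ) ℂ) : Prop :=
  ∃ (k : ℕ) (c : Matrix (Fin k) (Fin k) ℂ) (e : Fin k → β → ℂ) (f : Fin k → γ → ℂ),
    OrthonormalFam e ∧ OrthonormalFam f ∧
    ∀ p q, ρ p q = ∑ i, ∑ j,
      c i j * (e i p.1 * (starRingEnd ℂ) (e j q.1)) * (f i p.2 * (starRingEnd ℂ) (f j q.2))

/-- The matrix whose columns are the product vectors `u k ⊗ v k`. -/
def prodCols {α β κ : Type*} (u : κ → α → ℂ) (v : κ → β → ℂ) : Matrix (α × β) κ ℂ :=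
  fun p k => u k p.1 * v k p.2

theorem SeparableState.exists_eq_prodCols_mul_conjTranspose {α β : Type*} [Fintype α] [Fintype β]
    {ρ : Matrix (α × β) (α × β) ℂ} (h : SeparableState ρ) :
    ∃ (κ : Type) (_ : Fintype κ) (u : κ → α → ℂ) (v : κ → β → ℂ),
      ρ = prodCols u v * (prodCols u v)ᴴ := by
  obtain ⟨k, p, σ, τ, hp, -, hσ, hτ, rfl⟩ := h
  choose m x hx using fun i => Matrix.posSemidef_iff_eq_sum_vecMulVec.1 (hσ i).1
  choose n y hy using fun i => Matrix.posSemidef_iff_eq_sum_vecMulVec.1 (hτ i).1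
  refine ⟨Σ i : Fin k, Fin (m i) × Fin (n i), inferInstance,
    fun s => ((Real.sqrt (p s.1) : ℝ) : ℂ) • x s.1 s.2.1, fun s => y s.1 s.2.2, ?_⟩
  ext P Q
  have hsq (i : Fin k) : (p i : ℂ) = (Real.sqrt (p i) : ℂ) * (Real.sqrt (p i) : ℂ) := by
    rw [← Complex.ofReal_mul, Real.mul_self_sqrt (hp i)]
  simp only [Matrix.mul_apply, Matrix.conjTranspose_apply, Fintype.sum_sigma, Fintype.sum_prod_type,
    Matrix.sum_apply, Matrix.smul_apply, tens, prodCols]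
  refine Finset.sum_congr rfl fun i _ => ?_
  rw [hx i, hy i, hsq]
  simp only [Matrix.sum_apply, Matrix.vecMulVec_apply, Pi.star_apply]
  rw [Finset.sum_mul_sum]
  simp only [smul_eq_mul, Finset.mul_sum, Pi.smul_apply, star_mul', RCLike.star_def,
    Complex.conj_ofReal]
  refine Finset.sum_congr rfl fun j _ => Finset.sum_congr rfl fun l _ => ?_
  ring

theorem range_mulVecLin_self_mul_conjTranspose {m n : Type*} [Fintype m] [Fintype n]
    (M : Matrix m n ℂ) : (M * Mᴴ).mulVecLin.range = M.mulVecLin.range := by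
  refine Submodule.eq_of_le_of_finrank_le ?_ (Matrix.rank_self_mul_conjTranspose M).ge
  rw [Matrix.mulVecLin_mul]
  exact LinearMap.range_comp_le_range _ _

theorem linearIndependent_prod_of_left {α γ ι : Type*} {x : ι → α → ℂ}
    {y : ι → γ → ℂ} (hx : LinearIndependent ℂ x) (hy : ∀ i, y i ≠ 0) :
    LinearIndependent ℂ (prodCols x y).col := by
  rw [linearIndependent_iff'] at hx ⊢
  intro s g hg i hi
  obtain ⟨q, hq⟩ := Function.ne_iff.1 (hy i)
  have := hx s (fun j => g j * y j q) (by
    ext r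
    have := congrFun hg (r, q)
    simp only [Finset.sum_apply, Pi.smul_apply, smul_eq_mul, Matrix.col_apply, prodCols,
      Pi.zero_apply] at this ⊢
    rw [← this]
    exact Finset.sum_congr rfl fun j _ => by ring) i hi
  exact (mul_eq_zero.1 this).resolve_right hq

/-- If `M * Mᴴ` is separable then the column space of `M` contains linearly independent product
vectors whose first factors are linearly independent and span all the `α`-slices of `M`. -/
theorem SeparableState.exists_linearIndependent_prodCols {α β γ : Type*} [Fintype α] [Fintype β]
    [Fintype γ] {M : Matrix (α × γ) β ℂ} (h : SeparableState (M * Mᴴ)) :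
    ∃ (ι : Type) (_ : Fintype ι) (x : ι → α → ℂ) (y : ι → γ → ℂ),
      LinearIndependent ℂ x ∧ LinearIndependent ℂ (prodCols x y).col ∧
      (∀ i, (prodCols x y).col i ∈ M.mulVecLin.range) ∧
      ∀ r b, (fun i => M (i, r) b) ∈ Submodule.span ℂ (Set.range x) := by
  obtain ⟨κ, _, u, v, huv⟩ := h.exists_eq_prodCols_mul_conjTranspose
  have hrange : M.mulVecLin.range = (prodCols u v).mulVecLin.range := by
    rw [← range_mulVecLin_self_mul_conjTranspose M, huv, range_mulVecLin_self_mul_conjTranspose]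
  obtain ⟨ι, f, hf, hspan, hli⟩ :=
    exists_linearIndependent' ℂ (fun k : {k : κ // v k ≠ 0} => u k)
  have : Fintype ι := @Fintype.ofFinite _ (Finite.of_injective f hf)
  refine ⟨ι, this, _, fun i => v (f i), hli,
    linearIndependent_prod_of_left hli fun i => (f i).2, fun i => ?_, fun r b => ?_⟩
  · rw [hrange, Matrix.range_mulVecLin]
    exact Submodule.subset_span ⟨(f i : κ), rfl⟩
  · have hb : M.col b ∈ Submodule.span ℂ (Set.range (prodCols u v).col) := by
      rw [← Matrix.range_mulVecLin, ← hrange, Matrix.range_mulVecLin]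
      exact Submodule.subset_span ⟨b, rfl⟩
    obtain ⟨w, hw⟩ := (Submodule.mem_span_range_iff_exists_fun ℂ).1 hb
    have : (fun i => M (i, r) b) = ∑ k, (w k * v k r) • u k := by
      ext i
      have := congrFun hw (i, r)
      simp only [Finset.sum_apply, Pi.smul_apply, smul_eq_mul, Matrix.col_apply, prodCols]
        at this ⊢
      rw [← this]
      exact Finset.sum_congr rfl fun j _ => by ring
    rw [hspan, this]
    refine Submodule.sum_mem _ fun k _ => ?_
    by_cases hk : v k = 0
    · simp [hk]
    · exact Submodule.smul_mem _ _ (Submodule.subset_span ⟨⟨k, hk⟩, rfl⟩)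

theorem rank_le_finrank_span_of_row_mem {m n ι : Type*} [Fintype m] [Fintype n]
    (M : Matrix m n ℂ) {x : ι → n → ℂ}
    (h : ∀ i, M i ∈ Submodule.span ℂ (Set.range x)) :
    M.rank ≤ Set.finrank ℂ (Set.range x) := by
  rw [← Matrix.rank_transpose, Matrix.rank_eq_finrank_span_cols]
  refine Submodule.finrank_mono (Submodule.span_le.2 ?_)
  rintro _ ⟨i, rfl⟩
  exact h i

theorem card_le_rank_of_mem_range {m n ι : Type*} [Fintype m] [Fintype n] [Fintype ι]
    (M : Matrix m n ℂ) {x : ι → m → ℂ} (hx : LinearIndependent ℂ x)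
    (h : ∀ i, x i ∈ M.mulVecLin.range) : Fintype.card ι ≤ M.rank := by
  rw [← finrank_span_eq_card hx]
  refine Submodule.finrank_mono (Submodule.span_le.2 ?_)
  rintro _ ⟨i, rfl⟩
  exact h i

/-- A pure state with separable `AC` and `BC` marginals is a sum of product vectors whose `A` and
`B` factors are both linearly independent. -/
theorem exists_sum_prod_of_separable {α β γ : Type*} [Fintype α] [Fintype β] [Fintype γ]
    (ψ : α × β × γ → ℂ) (hAC : SeparableState (rhoAC ψ)) (hBC : SeparableState (rhoBC ψ)) :
    ∃ (ι : Type) (_ : Fintype ι) (x : ι → α → ℂ) (y : ι → β → ℂ) (z : ι → γ → ℂ),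
      LinearIndependent ℂ x ∧ LinearIndependent ℂ y ∧
      ∀ p q r, ψ (p, q, r) = ∑ i, x i p * y i q * z i r := by
  let M : Matrix (α × γ) β ℂ := fun s q => ψ (s.1, q, s.2)
  let N : Matrix (β × γ) α ℂ := fun s p => ψ (p, s.1, s.2)
  obtain ⟨ι, _, x, z, hx, hxz, hmem, hspan⟩ :=
    SeparableState.exists_linearIndependent_prodCols (M := M) hAC
  obtain ⟨ι', _, y', z', -, hyz', hmem', hspan'⟩ :=
    SeparableState.exists_linearIndependent_prodCols (M := N) hBC
  have hM : Fintype.card ι ≤ M.rank := card_le_rank_of_mem_range M hxz hmem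
  have hN : Fintype.card ι' ≤ N.rank := card_le_rank_of_mem_range N hyz' hmem'
  have hNM : N.rank ≤ Fintype.card ι :=
    (rank_le_finrank_span_of_row_mem N fun s => hspan s.2 s.1).trans (finrank_range_le_card x)
  have hMN : M.rank ≤ Fintype.card ι' :=
    (rank_le_finrank_span_of_row_mem M fun s => hspan' s.2 s.1).trans (finrank_range_le_card y')
  have heq : Submodule.span ℂ (Set.range (prodCols x z).col) = M.mulVecLin.range := by
    refine Submodule.eq_of_le_of_finrank_le (Submodule.span_le.2 ?_) ?_
    · rintro _ ⟨i, rfl⟩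
      exact hmem i
    · rw [finrank_span_eq_card hxz]
      exact hMN.trans (hN.trans hNM)
  have hcol (q : β) : ∃ w : ι → ℂ, ∑ i, w i • (prodCols x z).col i = M.col q := by
    rw [← Submodule.mem_span_range_iff_exists_fun, heq, Matrix.range_mulVecLin]
    exact Submodule.subset_span ⟨q, rfl⟩
  choose w hw using hcol
  have hψ (p : α) (q : β) (r : γ) : ψ (p, q, r) = ∑ i, x i p * w q i * z i r := by
    have := congrFun (hw q) (p, r)
    simp only [Finset.sum_apply, Pi.smul_apply, smul_eq_mul, Matrix.col_apply, prodCols] at this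
    refine this.symm.trans ?_
    exact Finset.sum_congr rfl fun i _ => by ring
  refine ⟨ι, inferInstance, x, fun i q => w q i, z, hx, ?_, hψ⟩
  rw [linearIndependent_iff_card_le_finrank_span]
  refine hM.trans (rank_le_finrank_span_of_row_mem M fun s => ?_)
  have : M s = ∑ i, (x i s.1 * z i s.2) • fun q => w q i := by
    ext q
    simp only [M, hψ, Finset.sum_apply, Pi.smul_apply, smul_eq_mul]
    exact Finset.sum_congr rfl fun i _ => by ring
  rw [this]
  exact Submodule.sum_mem _ fun i _ =>
    Submodule.smul_mem _ _ (Submodule.subset_span (Set.mem_range_self i))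

theorem exists_dual_of_linearIndependent {α ι : Type*} [Fintype α] [Fintype ι] [DecidableEq ι]
    {x : ι → α → ℂ} (hx : LinearIndependent ℂ x) :
    ∃ d : ι → α → ℂ, ∀ i j, ∑ p, d i p * x j p = if i = j then 1 else 0 := by
  classical
  obtain ⟨g, hg⟩ := LinearMap.exists_leftInverse_of_injective (Fintype.linearCombination ℂ x)
    (LinearMap.ker_eq_bot.2 hx.fintypeLinearCombination_injective)
  refine ⟨fun i p => g (Pi.single p 1) i, fun i j => ?_⟩
  have h1 := congrFun (LinearMap.congr_fun hg (Pi.single j 1)) i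
  have h2 : x j = ∑ p, x j p • (Pi.single p (1 : ℂ) : α → ℂ) := pi_eq_sum_univ' (x j)
  simp only [LinearMap.comp_apply, Fintype.linearCombination_apply_single, one_smul,
    LinearMap.id_apply] at h1
  rw [h2] at h1
  simp only [map_sum, map_smul, Finset.sum_apply, Pi.smul_apply, smul_eq_mul,
    Pi.single_apply] at h1
  rw [← h1]
  exact Finset.sum_congr rfl fun p _ => mul_comm _ _

theorem rhoAB_eq_sum {α β γ ι : Type*} [Fintype γ] [Fintype ι] {ψ : α × β × γ → ℂ}
    {x : ι → α → ℂ} {y : ι → β → ℂ} {z : ι → γ → ℂ}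
    (hψ : ∀ p q r, ψ (p, q, r) = ∑ i, x i p * y i q * z i r) (p q) :
    rhoAB ψ p q = ∑ k, ∑ l, (z k ⬝ᵥ star (z l)) *
      (x k p.1 * y k p.2 * star (x l q.1 * y l q.2)) := by
  simp only [rhoAB, hψ, map_sum, dotProduct]
  simp_rw [Finset.sum_mul_sum, Finset.sum_mul]
  rw [Finset.sum_comm]
  refine Finset.sum_congr rfl fun k _ => ?_
  rw [Finset.sum_comm]
  refine Finset.sum_congr rfl fun l _ => Finset.sum_congr rfl fun r _ => ?_
  simp only [map_mul, Pi.star_apply, star_mul', RCLike.star_def]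
  ring

theorem dotProduct_star_eq_zero_of_ppt {α β γ ι : Type*} [Fintype α] [Fintype β] [Fintype γ]
    [Fintype ι] {ψ : α × β × γ → ℂ} {x : ι → α → ℂ} {y : ι → β → ℂ} {z : ι → γ → ℂ}
    (hx : LinearIndependent ℂ x) (hy : LinearIndependent ℂ y)
    (hψ : ∀ p q r, ψ (p, q, r) = ∑ i, x i p * y i q * z i r)
    (hppt : (ptransB (rhoAB ψ)).PosSemidef) {i j : ι} (hij : i ≠ j) :
    z j ⬝ᵥ star (z i) = 0 := by
  classical
  obtain ⟨d, hd⟩ := exists_dual_of_linearIndependent hx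
  obtain ⟨e, he⟩ := exists_dual_of_linearIndependent hy
  let v : α × β → ℂ := fun s => star (d i s.1) * e j s.2
  have hd' (l : ι) : ∑ p, star (d i p) * star (x l p) = if i = l then 1 else 0 := by
    have := congrArg star (hd i l)
    simpa [apply_ite] using this
  have hmul (s : α × β) : (ptransB (rhoAB ψ) *ᵥ v) s =
      (z j ⬝ᵥ star (z i)) * (x j s.1 * star (y i s.2)) := by
    calc (ptransB (rhoAB ψ) *ᵥ v) s
        = ∑ k, ∑ l, (z k ⬝ᵥ star (z l)) * (x k s.1 * star (y l s.2)) *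
            ((∑ p, star (d i p) * star (x l p)) * ∑ q, e j q * y k q) := by
          rw [mulVec, dotProduct]
          simp_rw [ptransB, rhoAB_eq_sum hψ, Finset.sum_mul]
          rw [Finset.sum_comm]
          refine Finset.sum_congr rfl fun k _ => ?_
          rw [Finset.sum_comm]
          refine Finset.sum_congr rfl fun l _ => ?_
          simp_rw [Finset.mul_sum, Fintype.sum_prod_type, v, star_mul']
          exact Finset.sum_congr rfl fun p _ => Finset.sum_congr rfl fun q _ => by ring
      _ = _ := by
          simp_rw [hd', he]
          simp
  have hzero : star v ⬝ᵥ (ptransB (rhoAB ψ) *ᵥ v) = 0 := by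
    have : star v ⬝ᵥ (ptransB (rhoAB ψ) *ᵥ v) = (z j ⬝ᵥ star (z i)) *
        ((∑ p, d i p * x j p) * ∑ q, star (e j q) * star (y i q)) := by
      rw [dotProduct]
      simp_rw [hmul]
      rw [Fintype.sum_prod_type, Finset.sum_mul_sum, Finset.mul_sum]
      refine Finset.sum_congr rfl fun p _ => ?_
      rw [Finset.mul_sum]
      refine Finset.sum_congr rfl fun q _ => ?_
      simp only [v, Pi.star_apply, star_mul', star_star]
      ring
    rw [this, hd, if_neg hij, zero_mul, mul_zero]
  have hker := (hppt.dotProduct_mulVec_zero_iff v).1 hzero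
  obtain ⟨p, hp⟩ := Function.ne_iff.1 (hx.ne_zero j)
  obtain ⟨q, hq⟩ := Function.ne_iff.1 (hy.ne_zero i)
  have := congrFun hker (p, q)
  rw [hmul] at this
  exact (mul_eq_zero.1 this).resolve_right (mul_ne_zero hp (star_ne_zero.2 hq))

theorem isDensity_smul_vecMulVec {α : Type*} [Fintype α] {x : α → ℂ} (hx : x ≠ 0) :
    IsDensity ((x ⬝ᵥ star x)⁻¹ • vecMulVec x (star x)) := by
  refine ⟨(Matrix.posSemidef_vecMulVec_self_star x).smul
    (inv_nonneg.2 (dotProduct_self_star_nonneg x)), ?_⟩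
  rw [Matrix.trace_smul, Matrix.trace_vecMulVec, smul_eq_mul]
  exact inv_mul_cancel₀ (mt dotProduct_self_star_eq_zero.1 hx)

/-- A density matrix that is a nonnegative combination of product projections is separable. -/
theorem separableState_of_eq_sum {α β ι : Type*} [Fintype α] [Fintype β] [Fintype ι]
    {ρ : Matrix (α × β) (α × β) ℂ} (hρ : ρ.trace = 1) {g : ι → ℂ} {x : ι → α → ℂ} {y : ι → β → ℂ}
    (hg : ∀ i, 0 ≤ g i) (hx : ∀ i, x i ≠ 0) (hy : ∀ i, y i ≠ 0)
    (h : ρ = ∑ i, g i • tens (vecMulVec (x i) (star (x i))) (vecMulVec (y i) (star (y i)))) :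
    SeparableState ρ := by
  let P (i : ι) : ℂ := g i * (x i ⬝ᵥ star (x i)) * (y i ⬝ᵥ star (y i))
  have hP (i : ι) : 0 ≤ P i := mul_nonneg (mul_nonneg (hg i) (dotProduct_self_star_nonneg _))
    (dotProduct_self_star_nonneg _)
  have hre (i : ι) : ((P i).re : ℂ) = P i := (Complex.eq_re_of_ofReal_le (hP i)).symm
  have htr : ∑ i, P i = 1 := by
    rw [← hρ, h, Matrix.trace_sum]
    refine Finset.sum_congr rfl fun i _ => ?_
    simp only [P, Matrix.trace, Matrix.diag, Matrix.smul_apply, tens, smul_eq_mul,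
      Fintype.sum_prod_type, ← Finset.mul_sum, Finset.sum_mul_sum, mul_assoc, dotProduct,
      vecMulVec_apply]
  let e := (Fintype.equivFin ι).symm
  refine ⟨Fintype.card ι, fun k => (P (e k)).re,
    fun k => (x (e k) ⬝ᵥ star (x (e k)))⁻¹ • vecMulVec (x (e k)) (star (x (e k))),
    fun k => (y (e k) ⬝ᵥ star (y (e k)))⁻¹ • vecMulVec (y (e k)) (star (y (e k))),
    fun k => (Complex.nonneg_iff.1 (hP _)).1, ?_, fun k => isDensity_smul_vecMulVec (hx _),
    fun k => isDensity_smul_vecMulVec (hy _), ?_⟩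
  · rw [e.sum_comp (fun i => (P i).re), ← Complex.re_sum, htr, Complex.one_re]
  · simp only [hre]
    rw [e.sum_comp (fun i => P i • tens ((x i ⬝ᵥ star (x i))⁻¹ • vecMulVec (x i) (star (x i)))
      ((y i ⬝ᵥ star (y i))⁻¹ • vecMulVec (y i) (star (y i)))), h]
    refine Finset.sum_congr rfl fun i _ => ?_
    ext s t
    have h1 : x i ⬝ᵥ star (x i) ≠ 0 := mt dotProduct_self_star_eq_zero.1 (hx i)
    have h2 : y i ⬝ᵥ star (y i) ≠ 0 := mt dotProduct_self_star_eq_zero.1 (hy i)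
    simp only [P, Matrix.smul_apply, tens, smul_eq_mul]
    field_simp

theorem trace_rhoAB {α β γ : Type*} [Fintype α] [Fintype β] [Fintype γ] {ψ : α × β × γ → ℂ}
    (hψ : UnitVec ψ) : (rhoAB ψ).trace = 1 := by
  have := congrArg ((↑) : ℝ → ℂ) hψ
  simpa [Matrix.trace, rhoAB, Fintype.sum_prod_type, Complex.mul_conj] using this

/-- no tripartite pure state has ρ_AC and ρ_BC separable while
ρ_AB is PPT and entangled. -/
theorem no_two_separable_one_ppt_entangled {a b c : ℕ}
    (ψ : Fin a × Fin b × Fin c → ℂ) (hψ : UnitVec ψ)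
    (hAC : SeparableState (rhoAC ψ)) (hBC : SeparableState (rhoBC ψ))
    (hppt : (ptransB (rhoAB ψ)).PosSemidef)
    (hent : ¬SeparableState (rhoAB ψ)) : False := by
  obtain ⟨ι, _, x, y, z, hx, hy, hsum⟩ := exists_sum_prod_of_separable ψ hAC hBC
  refine hent (separableState_of_eq_sum (trace_rhoAB hψ) (g := fun i => z i ⬝ᵥ star (z i))
    (fun i => dotProduct_self_star_nonneg _) hx.ne_zero hy.ne_zero ?_)
  ext p q
  rw [rhoAB_eq_sum hsum, Matrix.sum_apply]
  refine Finset.sum_congr rfl fun k _ => ?_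
  rw [Finset.sum_eq_single k (fun l _ hl => by
    rw [dotProduct_star_eq_zero_of_ppt hx hy hsum hppt hl, zero_mul]) (by simp)]
  simp only [Matrix.smul_apply, tens, vecMulVec_apply, smul_eq_mul, Pi.star_apply, star_mul']
  ring

end
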